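/- Let a, b, Q, R > 0 and q ∈ (0, 1/a²). For q̂ ∈ [0, 1/a²) let P̂(q̂) denote the unique positive solution of P̂ = Q + a²P̂ − (1−q̂)a²b²P̂²/(R + b²P̂). Then q̂ ↦ P̂(q̂) is continuous at q; in particular lim_{q̂→q} P̂(q̂) = P̂(q). -/

import Mathlib

/-- Continuity of the scalar modified Riccati solution in the packet loss
rate, at the true rate `q`. -/
theorem stmt_16 (a b Q R q : ℝ)
    (ha : 0 < a) (hb : 0 < b) (hQ : 0 < Q) (hR : 0 < R)
    (hq : q ∈ Set.Ioo (0:ℝ) (1/a^2))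
    (Pfun : ℝ → ℝ)
    (hPpos : ∀ s ∈ Set.Ico (0:ℝ) (1/a^2), 0 < Pfun s)
    (hPfix : ∀ s ∈ Set.Ico (0:ℝ) (1/a^2),
      Pfun s = Q + a^2*(Pfun s) - (1 - s) * (a^2*b^2*(Pfun s)^2/(R + b^2*(Pfun s))))
    (hPuniq : ∀ s ∈ Set.Ico (0:ℝ) (1/a^2), ∀ x : ℝ, 0 < x →
      x = Q + a^2*x - (1 - s) * (a^2*b^2*x^2/(R + b^2*x)) → x = Pfun s) :
    ContinuousWithinAt Pfun (Set.Ico (0:ℝ) (1/a^2)) q := by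
  have hApos : ∀ s ∈ Set.Ico (0:ℝ) (1/a^2), 0 < b^2*(1 - s*a^2) := by
    intro s hs
    have h := (lt_div_iff₀ (by positivity : (0:ℝ) < a^2)).1 hs.2
    exact mul_pos (by positivity) (by linarith)
  have key : ∀ s ∈ Set.Ico (0:ℝ) (1/a^2), Pfun s =
      (-(R*(1-a^2) - Q*b^2) + Real.sqrt ((R*(1-a^2) - Q*b^2)^2 + 4*(b^2*(1 - s*a^2))*(Q*R)))
        / (2*(b^2*(1 - s*a^2))) := by
    intro s hs
    have hA := hApos s hs
    have hx := hPpos s hs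
    have hf := hPfix s hs
    generalize Pfun s = x at hx hf
    have hD : 0 < R + b^2*x := by positivity
    have hquad : (b^2*(1 - s*a^2))*x^2 + (R*(1-a^2) - Q*b^2)*x - Q*R = 0 := by
      have h2 : (1 - s) * (a^2*b^2*x^2/(R + b^2*x)) = Q + a^2*x - x := by linarith
      rw [← mul_div_assoc, div_eq_iff hD.ne'] at h2
      linear_combination h2
    generalize b^2*(1 - s*a^2) = A at hA hquad
    generalize R*(1-a^2) - Q*b^2 = B at hquad
    have hpos : 0 ≤ 2*A*x + B := by
      have h1 : 0 < (2*A*x + B)*x := by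
        have : (2*A*x + B)*x = A*x^2 + Q*R := by linear_combination hquad
        rw [this]; positivity
      exact (pos_of_mul_pos_left h1 hx.le).le
    have hsq : B^2 + 4*A*(Q*R) = (2*A*x + B)^2 := by linear_combination (-4*A)*hquad
    rw [hsq, Real.sqrt_sq hpos, eq_div_iff (by positivity)]
    ring
  have hqI : q ∈ Set.Ico (0:ℝ) (1/a^2) := ⟨hq.1.le, hq.2⟩
  refine ContinuousWithinAt.congr (ContinuousAt.continuousWithinAt ?_) key (key q hqI)
  have hA := hApos q hqI
  refine ContinuousAt.div (by fun_prop) (by fun_prop) (by positivity)
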